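/- Let K = u/v be shift-reduced with K ≠ 1, set α₁ = deg(u), β = deg(v − u), and τ_K = lc(v − u)/lc(u). Suppose β = α₁ − 1 and τ_K = m·1_F for a positive natural number m. Then: deg(φ_K(y^i)) = α₁ + i − 1 for every natural number i ≠ m; deg(φ_K(p)) < α₁ + m − 1 for every p ∈ F[y] with deg(p) = m; no nonzero element of the image of φ_K has degree α₁ + m − 1 (so y^{α₁+m−1} ∈ W_K); and dim_F(W_K) = α₁ − 1. -/

import Mathlib

open Polynomial

noncomputable def pshift (F : Type*) [Field F] (i : ℤ) :
    Polynomial F →ₐ[F] Polynomial F :=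
  aeval (X + C (i : F))

noncomputable def rshift (F : Type*) [Field F] (i : ℤ) : RatFunc F → RatFunc F :=
  fun f => RatFunc.mk (pshift F i f.num) (pshift F i f.denom)

def shiftFree {F : Type*} [Field F] (p : Polynomial F) : Prop :=
  p ≠ 0 ∧ ∀ i : ℤ, i ≠ 0 → IsCoprime p (pshift F i p)

def shiftReducedPair {F : Type*} [Field F] (u v : Polynomial F) : Prop :=
  u ≠ 0 ∧ v ≠ 0 ∧ IsCoprime u v ∧ ∀ i : ℤ, IsCoprime u (pshift F i v)

def stronglyPrime {F : Type*} [Field F] (p u v : Polynomial F) : Prop :=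
  p ≠ 0 ∧ ∀ i : ℕ, IsCoprime p (pshift F (-(i : ℤ)) u) ∧ IsCoprime p (pshift F (i : ℤ) v)

noncomputable def phiK {F : Type*} [Field F] (u v : Polynomial F) :
    Polynomial F → Polynomial F :=
  fun p => u * pshift F 1 p - v * p

noncomputable def WK (F : Type*) [Field F] (u v : Polynomial F) :
    Submodule F (Polynomial F) :=
  Submodule.span F {q : Polynomial F | ∃ ℓ : ℕ, q = X ^ ℓ ∧
    ∀ w : Polynomial F, w ∈ Set.range (phiK u v) → w ≠ 0 → ℓ ≠ w.natDegree}

def VK {F : Type*} [Field F] (K : RatFunc F) : Set (RatFunc F) :=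
  {g | ∃ r : RatFunc F, g = K * rshift F 1 r - r}

def residualForm {F : Type*} [Field F] (u v : Polynomial F) (r : RatFunc F) : Prop :=
  ∃ a b q : Polynomial F, a.degree < b.degree ∧ shiftFree b ∧ stronglyPrime b u v ∧
    q ∈ WK F u v ∧ r = RatFunc.mk a b + RatFunc.mk q v

theorem pshift_one_eq_taylor {F : Type*} [Field F] (p : Polynomial F) :
    pshift F 1 p = taylor 1 p := by
  simp [pshift, taylor_apply, comp, aeval_def, algebraMap_eq]

theorem pshift_add_one {F : Type*} [Field F] (i : ℤ) (p : Polynomial F) :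
    pshift F 1 (pshift F i p) = pshift F (i + 1) p := by
  have h : (pshift F 1).comp (pshift F i) = pshift F (i + 1) := by
    ext
    simp [pshift, add_assoc, add_comm]
  exact DFunLike.congr_fun h p

theorem pshift_neg_cancel {F : Type*} [Field F] (i : ℤ) (p : Polynomial F) :
    pshift F i (pshift F (-i) p) = p := by
  have h : (pshift F i).comp (pshift F (-i)) = AlgHom.id F _ := by
    ext
    simp [pshift]
  exact DFunLike.congr_fun h p

theorem natDegree_pshift {F : Type*} [Field F] (i : ℤ) (p : Polynomial F) :
    (pshift F i p).natDegree = p.natDegree := by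
  have h : pshift F i p = taylor (i : F) p := by
    simp [pshift, taylor_apply, comp, aeval_def, algebraMap_eq]
  rw [h, natDegree_taylor]

noncomputable def phiKLinear {F : Type*} [Field F] (u v : Polynomial F) :
    Polynomial F →ₗ[F] Polynomial F :=
  LinearMap.mulLeft F u ∘ₗ (pshift F 1).toLinearMap - LinearMap.mulLeft F v

theorem phiKLinear_apply {F : Type*} [Field F] (u v p : Polynomial F) :
    phiKLinear u v p = phiK u v p := rfl

theorem phiK_eq {F : Type*} [Field F] (u v p : Polynomial F) :
    phiK u v p = u * (taylor 1 p - p) - (v - u) * p := by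
  rw [phiK, pshift_one_eq_taylor]
  ring

theorem phiKLinear_ker {F : Type*} [Field F] {u v : Polynomial F}
    (hsr : shiftReducedPair u v) (hu : 0 < u.natDegree) {p : Polynomial F}
    (hp : phiKLinear u v p = 0) : p = 0 := by
  have hc (n : ℕ) : IsCoprime (pshift F n u) v := by
    have := (hsr.2.2.2 (-n)).map (pshift F n).toRingHom
    simpa [pshift_neg_cancel] using this
  have key : ∀ k n : ℕ, ∀ p : Polynomial F, p.natDegree ≤ k →
      pshift F n u * pshift F 1 p = v * p → p = 0 := by
    intro k
    induction k with
    | zero =>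
      intro n p hk h
      by_contra hp0
      have hdvd : pshift F n u ∣ p := (hc n).dvd_of_dvd_mul_left ⟨_, h.symm⟩
      have := natDegree_le_of_dvd hdvd hp0
      rw [natDegree_pshift] at this
      omega
    | succ k ih =>
      intro n p hk h
      by_contra hp0
      obtain ⟨q, rfl⟩ : pshift F n u ∣ p := (hc n).dvd_of_dvd_mul_left ⟨_, h.symm⟩
      have hne := mul_ne_zero_iff.mp hp0
      rw [natDegree_mul hne.1 hne.2, natDegree_pshift] at hk
      refine hne.2 (ih (n + 1) q (by omega) ?_)
      rw [map_mul, pshift_add_one] at h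
      apply mul_left_cancel₀ hne.1
      push_cast
      linear_combination h
  refine key p.natDegree 0 p le_rfl ?_
  have h0 : pshift F 0 u = u := by simp [pshift]
  rw [phiKLinear_apply, phiK, sub_eq_zero] at hp
  simpa [h0] using hp

theorem coeff_taylor_one_sub {F : Type*} [Field F] {p : Polynomial F} {i : ℕ}
    (hp : p.natDegree ≤ i + 1) :
    (taylor 1 p - p).natDegree ≤ i ∧
      (taylor 1 p - p).coeff i = (i + 1) * p.coeff (i + 1) := by
  constructor
  · rw [natDegree_le_iff_coeff_eq_zero]
    intro k hk
    have hH : (hasseDeriv k p).natDegree < 1 := by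
      have := natDegree_hasseDeriv_le p k
      omega
    rw [coeff_sub, taylor_coeff, eval_eq_sum_range' hH]
    simp [hasseDeriv_coeff]
  · have hH : (hasseDeriv i p).natDegree < 2 := by
      have := natDegree_hasseDeriv_le p i
      omega
    rw [coeff_sub, taylor_coeff, eval_eq_sum_range' hH]
    simp [hasseDeriv_coeff, Finset.sum_range_succ, add_comm 1 i]

section Degrees

variable {F : Type*} [Field F] {u v : Polynomial F} {a m : ℕ}

theorem phiK_degree_and_coeff (hu : u.natDegree = a + 1) (hd : (v - u).natDegree = a)
    (hlc : (v - u).leadingCoeff = m * u.leadingCoeff) {p : Polynomial F} {i : ℕ}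
    (hp : p.natDegree ≤ i) :
    (phiK u v p).natDegree ≤ a + i ∧
      (phiK u v p).coeff (a + i) = ((i : F) - m) * u.leadingCoeff * p.coeff i := by
  have h2 : ((v - u) * p).natDegree ≤ a + i := natDegree_mul_le_of_le hd.le hp
  have h3 : ((v - u) * p).coeff (a + i) = m * u.leadingCoeff * p.coeff i := by
    rw [coeff_mul_add_eq_of_natDegree_le hd.le hp, ← hlc, leadingCoeff, hd]
  have h1 : (u * (taylor 1 p - p)).natDegree ≤ a + i ∧
      (u * (taylor 1 p - p)).coeff (a + i) = i * u.leadingCoeff * p.coeff i := by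
    cases i with
    | zero =>
      rw [eq_C_of_natDegree_le_zero hp]
      simp
    | succ i =>
      obtain ⟨h, h'⟩ := coeff_taylor_one_sub hp
      rw [show a + (i + 1) = a + 1 + i by ring]
      refine ⟨natDegree_mul_le_of_le hu.le h, ?_⟩
      rw [coeff_mul_add_eq_of_natDegree_le hu.le h, h', leadingCoeff, hu]
      push_cast
      ring
  rw [phiK_eq]
  refine ⟨(natDegree_sub_le _ _).trans (max_le h1.1 h2), ?_⟩
  rw [coeff_sub, h1.2, h3]
  ring

theorem phiK_natDegree_of_ne [CharZero F] (hu : u.natDegree = a + 1)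
    (hd : (v - u).natDegree = a)
    (hlc : (v - u).leadingCoeff = m * u.leadingCoeff) {p : Polynomial F} (hp : p ≠ 0)
    (hm : p.natDegree ≠ m) : (phiK u v p).natDegree = a + p.natDegree := by
  obtain ⟨h, h'⟩ := phiK_degree_and_coeff hu hd hlc (le_refl p.natDegree)
  refine le_antisymm h (le_natDegree_of_ne_zero ?_)
  have hu0 : u ≠ 0 := by
    rintro rfl
    simp at hu
  rw [h']
  refine mul_ne_zero (mul_ne_zero (sub_ne_zero.mpr ?_) (leadingCoeff_ne_zero.mpr hu0))
    (leadingCoeff_ne_zero.mpr hp)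
  exact_mod_cast hm

theorem phiK_natDegree_lt (hu : u.natDegree = a + 1) (hd : (v - u).natDegree = a)
    (hlc : (v - u).leadingCoeff = m * u.leadingCoeff) (hm : 0 < m) {p : Polynomial F}
    (hp : p.natDegree ≤ m) : (phiK u v p).natDegree < a + m := by
  obtain ⟨h, h'⟩ := phiK_degree_and_coeff hu hd hlc hp
  refine lt_of_le_of_ne h fun he => ?_
  rw [sub_self, zero_mul, zero_mul, ← he, coeff_natDegree, leadingCoeff_eq_zero] at h'
  rw [h', natDegree_zero] at he
  omega

theorem exists_sub_phiKLinear_mem_degreeLT [CharZero F] (hu : u.natDegree = a + 1)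
    (hd : (v - u).natDegree = a)
    (hlc : (v - u).leadingCoeff = m * u.leadingCoeff) {j : ℕ} (hj : j ≤ m)
    {w : Polynomial F} (hw : w ∈ degreeLT F (a + j)) :
    ∃ q ∈ degreeLT F j, w - phiKLinear u v q ∈ degreeLT F a := by
  induction j generalizing w with
  | zero => exact ⟨0, zero_mem _, by simpa using hw⟩
  | succ j ih =>
    have hu0 : u ≠ 0 := by
      rintro rfl
      simp at hu
    have hne : ((j : F) - m) * u.leadingCoeff ≠ 0 := by
      refine mul_ne_zero (sub_ne_zero.mpr ?_) (leadingCoeff_ne_zero.mpr hu0)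
      exact_mod_cast (show j ≠ m by omega)
    let c := w.coeff (a + j) / (((j : F) - m) * u.leadingCoeff)
    obtain ⟨h, h'⟩ := phiK_degree_and_coeff hu hd hlc (natDegree_C_mul_X_pow_le c j)
    have hmem : w - phiKLinear u v (C c * X ^ j) ∈ degreeLT F (a + j) := by
      rw [mem_degreeLT, degree_lt_iff_coeff_zero] at hw ⊢
      intro k hk
      rw [phiKLinear_apply, coeff_sub]
      rcases hk.eq_or_lt with rfl | hk
      · rw [h', coeff_C_mul_X_pow, if_pos rfl, mul_div_cancel₀ _ hne, sub_self]
      · rw [hw k (by omega), coeff_eq_zero_of_natDegree_lt (h.trans_lt hk), sub_zero]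
    obtain ⟨q, hq, hq'⟩ := ih (by omega) hmem
    refine ⟨C c * X ^ j + q, add_mem ?_ (degreeLT_mono (by omega) hq), ?_⟩
    · rw [mem_degreeLT]
      exact (degree_C_mul_X_pow_le j c).trans_lt (by exact_mod_cast Nat.lt_succ_self j)
    · rwa [map_add, ← sub_sub]

theorem exists_phiKLinear_mem_degreeLT [CharZero F] (hu : u.natDegree = a + 1)
    (hd : (v - u).natDegree = a)
    (hlc : (v - u).leadingCoeff = m * u.leadingCoeff) (hm : 0 < m) :
    ∃ p : Polynomial F, p.natDegree = m ∧ phiKLinear u v p ∈ degreeLT F a := by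
  have hw : phiKLinear u v (X ^ m) ∈ degreeLT F (a + m) := by
    rw [mem_degreeLT]
    refine degree_le_natDegree.trans_lt ?_
    exact_mod_cast phiK_natDegree_lt hu hd hlc hm (natDegree_X_pow m).le
  obtain ⟨q, hq, hq'⟩ := exists_sub_phiKLinear_mem_degreeLT hu hd hlc le_rfl hw
  refine ⟨X ^ m - q, ?_, by rwa [map_sub]⟩
  apply natDegree_eq_of_degree_eq_some
  rw [mem_degreeLT] at hq
  rw [degree_sub_eq_left_of_degree_lt (by rwa [degree_X_pow]), degree_X_pow]

theorem eq_zero_of_phiKLinear_mem_degreeLT [CharZero F] (hu : u.natDegree = a + 1)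
    (hd : (v - u).natDegree = a)
    (hlc : (v - u).leadingCoeff = m * u.leadingCoeff)
    (hker : ∀ p, phiKLinear u v p = 0 → p = 0) {p : Polynomial F}
    (hp : p.natDegree ≠ m) (h : phiKLinear u v p ∈ degreeLT F a) : p = 0 := by
  by_contra hp0
  have h1 := phiK_natDegree_of_ne hu hd hlc hp0 hp
  rw [mem_degreeLT, degree_eq_natDegree (mt (hker p) hp0)] at h
  rw [phiKLinear_apply, h1] at h
  have : a + p.natDegree < a := by exact_mod_cast h
  omega

theorem exists_gap_set_eq [CharZero F] (hu : u.natDegree = a + 1)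
    (hd : (v - u).natDegree = a)
    (hlc : (v - u).leadingCoeff = m * u.leadingCoeff) (hm : 0 < m)
    (hker : ∀ p, phiKLinear u v p = 0 → p = 0) :
    ∃ d < a, ∀ ℓ : ℕ,
      (∀ w : Polynomial F, w ∈ Set.range (phiK u v) → w ≠ 0 → ℓ ≠ w.natDegree) ↔
        ℓ ∈ insert (a + m) ((Finset.range a).erase d) := by
  obtain ⟨p, hpm, hp⟩ := exists_phiKLinear_mem_degreeLT hu hd hlc hm
  have hp0 : p ≠ 0 := by
    rintro rfl
    simp at hpm
    omega
  have hφ0 : phiKLinear u v p ≠ 0 := mt (hker p) hp0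
  refine ⟨(phiKLinear u v p).natDegree, ?_, fun ℓ => ?_⟩
  · rw [mem_degreeLT, degree_eq_natDegree hφ0] at hp
    exact_mod_cast hp
  rw [Finset.mem_insert, Finset.mem_erase, Finset.mem_range]
  constructor
  · intro h
    by_contra! hcon
    obtain ⟨h1, h2⟩ := hcon
    by_cases hℓ : ℓ < a
    · have hne : ℓ ≠ (phiKLinear u v p).natDegree := h _ ⟨p, rfl⟩ hφ0
      exact absurd (h2 hne) (by omega)
    · have hX : (X ^ (ℓ - a) : Polynomial F) ≠ 0 := pow_ne_zero _ X_ne_zero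
      have := phiK_natDegree_of_ne hu hd hlc hX (by rw [natDegree_X_pow]; omega)
      rw [natDegree_X_pow] at this
      exact h _ ⟨_, rfl⟩ (mt (hker _) hX) (by omega)
  · rintro h _ ⟨q, rfl⟩ hq rfl
    have hq0 : q ≠ 0 := by
      rintro rfl
      exact hq (map_zero (phiKLinear u v))
    by_cases hqm : q.natDegree = m
    · have hlt := phiK_natDegree_lt hu hd hlc hm hqm.le
      rcases h with h | ⟨h1, h2⟩
      · omega
      · have hqmem : phiKLinear u v q ∈ degreeLT F a := by
          rw [mem_degreeLT]
          exact degree_le_natDegree.trans_lt (by exact_mod_cast h2)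
        set c := q.leadingCoeff / p.leadingCoeff with hc
        have hplc := leadingCoeff_ne_zero.mpr hp0
        have hc0 : c ≠ 0 := div_ne_zero (leadingCoeff_ne_zero.mpr hq0) hplc
        have hr : q - c • p = 0 := by
          refine eq_zero_of_phiKLinear_mem_degreeLT hu hd hlc hker (fun hdeg => ?_) ?_
          · have h0 : (q - c • p).coeff m = 0 := by
              rw [coeff_sub, coeff_smul, smul_eq_mul]
              nth_rewrite 1 [← hqm]
              rw [← hpm, coeff_natDegree, coeff_natDegree, hc]
              field_simp
              ring
            rw [← hdeg, coeff_natDegree, leadingCoeff_eq_zero] at h0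
            rw [h0, natDegree_zero] at hdeg
            omega
          · rw [map_sub, map_smul]
            exact sub_mem hqmem (Submodule.smul_mem _ _ hp)
        apply h1
        rw [sub_eq_zero.mp hr, ← phiKLinear_apply, map_smul, natDegree_smul _ hc0]
    · have := phiK_natDegree_of_ne hu hd hlc hq0 hqm
      omega

end Degrees

theorem finrank_WK_eq_card {F : Type*} [Field F] {u v : Polynomial F} {s : Finset ℕ}
    (hs : ∀ ℓ : ℕ,
      (∀ w : Polynomial F, w ∈ Set.range (phiK u v) → w ≠ 0 → ℓ ≠ w.natDegree) ↔ ℓ ∈ s) :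
    Module.finrank F (WK F u v) = s.card := by
  have hli : LinearIndependent F (fun ℓ : s => (X : Polynomial F) ^ (ℓ : ℕ)) := by
    have := (basisMonomials F).linearIndependent.comp _ (Subtype.val_injective (p := (· ∈ s)))
    simpa [Function.comp_def, monomial_one_right_eq_X_pow] using this
  have hW : WK F u v = Submodule.span F
      (Set.range fun ℓ : s => (X : Polynomial F) ^ (ℓ : ℕ)) := by
    rw [WK]
    congr 1
    ext q
    simp [← hs, eq_comm, and_comm]
  rw [hW, finrank_span_eq_card hli, Fintype.card_coe]


/-- Case β = α₁ − 1 and τ_K = m a positive integer. -/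
theorem stmt10 {F : Type*} [Field F] [CharZero F] (u v : Polynomial F) (m : ℕ)
    (hsr : shiftReducedPair u v) (hK1 : RatFunc.mk u v ≠ 1)
    (hcase : ((v - u).natDegree : ℤ) = (u.natDegree : ℤ) - 1)
    (hm : 0 < m) (htau : (v - u).leadingCoeff / u.leadingCoeff = (m : F)) :
    (∀ i : ℕ, i ≠ m → (phiK u v (X ^ i)).natDegree = u.natDegree + i - 1) ∧
    (∀ p : Polynomial F, p.natDegree = m →
        (phiK u v p).natDegree < u.natDegree + m - 1) ∧
    (∀ w : Polynomial F, w ∈ Set.range (phiK u v) → w ≠ 0 →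
        w.natDegree ≠ u.natDegree + m - 1) ∧
    (X : Polynomial F) ^ (u.natDegree + m - 1) ∈ WK F u v ∧
    Module.finrank F (WK F u v) = u.natDegree - 1 := by
  have ⟨a, hu⟩ : ∃ a, u.natDegree = a + 1 := ⟨u.natDegree - 1, by omega⟩
  have hd : (v - u).natDegree = a := by omega
  have hlc : (v - u).leadingCoeff = m * u.leadingCoeff :=
    (div_eq_iff (leadingCoeff_ne_zero.mpr hsr.1)).mp htau
  have hker : ∀ p, phiKLinear u v p = 0 → p = 0 := fun p =>
    phiKLinear_ker hsr (by omega)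
  obtain ⟨d, hda, hgap⟩ := exists_gap_set_eq hu hd hlc hm hker
  have htop := (hgap (a + m)).mpr (Finset.mem_insert_self _ _)
  have hidx : ∀ i, u.natDegree + i - 1 = a + i := fun i => by omega
  simp only [hidx]
  refine ⟨fun i hi => ?_, fun p hp => phiK_natDegree_lt hu hd hlc hm hp.le,
    fun w hw hw0 => (htop w hw hw0).symm, Submodule.subset_span ⟨_, rfl, htop⟩, ?_⟩
  · rw [phiK_natDegree_of_ne hu hd hlc (pow_ne_zero _ X_ne_zero)
      (by rwa [natDegree_X_pow]), natDegree_X_pow]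
  · rw [finrank_WK_eq_card hgap, Finset.card_insert_of_notMem (by simp),
      Finset.card_erase_of_mem (Finset.mem_range.mpr hda), Finset.card_range]
    omega
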